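/- arXiv:2106.13910 — 3 statements merged into one kernel-verified Lean document; each statement's English description precedes it below -/
import Mathlib

section
/- Let m ≥ 3 and let f be a Boolean function on m variables of degree at most m−3. If f has no affine factor — that is, there do not exist a Boolean function a of degree exactly 1 and a Boolean function g on m variables with f(v) = a(v)·g(v) for all v ∈ 𝔽₂^m — then the weight of f is at least 2m+2. -/
open MvPolynomial

/-- A Boolean function on `m` variables over 𝔽₂. -/
abbrev BF (m : ℕ) := (Fin m → ZMod 2) → ZMod 2

/-- The unique multilinear polynomial over 𝔽₂ representing the Boolean function `f`
(obtained by interpolation: `∏ i (Xᵢ + vᵢ + 1)` is the indicator of the input `v`). -/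
noncomputable def repPoly {m : ℕ} (f : BF m) : MvPolynomial (Fin m) (ZMod 2) :=
  ∑ v : Fin m → ZMod 2, f v • ∏ i : Fin m, (X i + C (v i + 1))

/-- The degree of a Boolean function: the total degree of its multilinear representative. -/
noncomputable def deg {m : ℕ} (f : BF m) : ℕ := (repPoly f).totalDegree

/-- The weight of a Boolean function: the number of inputs on which it takes the value 1. -/
noncomputable def wt {m : ℕ} (f : BF m) : ℕ :=
  (Finset.univ.filter fun v => f v = 1).card

/-- The distance from `f` to the Reed–Muller code `RM(r,m)`: the minimum weight of
`f + p` over Boolean functions `p` of degree at most `r`. -/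
noncomputable def distRM (m r : ℕ) (f : BF m) : ℕ :=
  sInf {w | ∃ p : BF m, deg p ≤ r ∧ wt (f + p) = w}

theorem ZMod.eq_zero_or_eq_one_of_two (x : ZMod 2) : x = 0 ∨ x = 1 := by
  revert x; decide

theorem eval_repPoly {m : ℕ} (f : BF m) (v : Fin m → ZMod 2) : eval v (repPoly f) = f v := by
  classical
  unfold repPoly
  rw [map_sum, Finset.sum_eq_single v]
  · have h : ∀ x : ZMod 2, x + (x + 1) = 1 := by decide
    simp [smul_eval, h]
  · intro w _ hw
    obtain ⟨i, hi⟩ := Function.ne_iff.mp hw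
    have h : ∀ x y : ZMod 2, x ≠ y → y + (x + 1) = 0 := by decide
    rw [smul_eval, eval_prod, Finset.prod_eq_zero (Finset.mem_univ i) (by simpa using h _ _ hi),
      mul_zero]
  · simp

theorem degreeOf_repPoly_le_one {m : ℕ} (f : BF m) (i : Fin m) :
    (repPoly f).degreeOf i ≤ 1 := by
  classical
  unfold repPoly
  refine (degreeOf_sum_le i _ _).trans (Finset.sup_le fun v _ => ?_)
  rw [smul_eq_C_mul]
  refine (degreeOf_C_mul_le _ _ _).trans ((degreeOf_prod_le i _ _).trans ?_)
  calc ∑ j : Fin m, degreeOf i (X j + C (v j + 1) : MvPolynomial (Fin m) (ZMod 2))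
      ≤ ∑ j : Fin m, if i = j then 1 else 0 := by
        refine Finset.sum_le_sum fun j _ => (degreeOf_add_le i _ _).trans ?_
        rw [degreeOf_C, degreeOf_X]
        simp
    _ = 1 := by simp

/-- A multilinear polynomial is the representative of the Boolean function it evaluates to. -/
theorem repPoly_eval {m : ℕ} (p : MvPolynomial (Fin m) (ZMod 2))
    (hp : ∀ i, p.degreeOf i ≤ 1) : repPoly (fun v => eval v p) = p := by
  rw [← sub_eq_zero]
  refine eq_zero_of_eval_eq_zero _ _ _ (fun v => ?_) ?_
  · rw [map_sub, eval_repPoly, sub_self]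
  · rw [ZMod.card]
    refine Submodule.sub_mem _ ?_ ?_ <;> rw [mem_restrictDegree]
    · exact fun s hs i => (monomial_le_degreeOf i hs).trans (degreeOf_repPoly_le_one _ i)
    · exact fun s hs i => (monomial_le_degreeOf i hs).trans (hp i)

/-- The basis `1, X₁, …, X_m` of the affine polynomials. -/
noncomputable def affineBasis (m : ℕ) : Option (Fin m) → MvPolynomial (Fin m) (ZMod 2)
  | none => 1
  | some i => X i

/-- The affine polynomial with prescribed coefficients. -/
noncomputable def affinePoly {m : ℕ} (w : Option (Fin m) → ZMod 2) :
    MvPolynomial (Fin m) (ZMod 2) :=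
  ∑ j, C (w j) * affineBasis m j

theorem totalDegree_affineBasis_le {m : ℕ} (j : Option (Fin m)) :
    (affineBasis m j).totalDegree ≤ 1 := by
  cases j <;> simp [affineBasis]

theorem totalDegree_affinePoly_le {m : ℕ} (w : Option (Fin m) → ZMod 2) :
    (affinePoly w).totalDegree ≤ 1 := by
  refine (totalDegree_finsetSum _ _).trans (Finset.sup_le fun j _ => ?_)
  refine (totalDegree_mul _ _).trans ?_
  simpa using totalDegree_affineBasis_le j

theorem eval_affinePoly {m : ℕ} (w : Option (Fin m) → ZMod 2) (v : Fin m → ZMod 2) :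
    eval v (affinePoly w) = w none + ∑ i, w (some i) * v i := by
  simp [affinePoly, affineBasis, Fintype.sum_option]

theorem deg_affinePoly {m : ℕ} (w : Option (Fin m) → ZMod 2) (i : Fin m) (hi : w (some i) ≠ 0) :
    deg (fun v => eval v (affinePoly w)) = 1 := by
  classical
  have hle := totalDegree_affinePoly_le w
  unfold deg
  rw [repPoly_eval _ fun k => (degreeOf_le_totalDegree _ k).trans hle]
  refine le_antisymm hle (Nat.one_le_iff_ne_zero.mpr fun h => hi ?_)
  rw [totalDegree_eq_zero_iff_eq_C] at h
  have h₀ := eval_affinePoly w 0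
  have h₁ := eval_affinePoly w (Pi.single i 1)
  rw [h, eval_C] at h₀ h₁
  simpa [Pi.single_apply] using h₁.symm.trans h₀

/-- If `f` has no affine factor, no nonzero affine polynomial vanishes on its support. -/
theorem eq_zero_of_eval_affinePoly_eq_zero {m : ℕ} (hm : 0 < m) {f : BF m}
    (hf : ¬ ∃ (a g : BF m), deg a = 1 ∧ ∀ v : Fin m → ZMod 2, f v = a v * g v)
    (w : Option (Fin m) → ZMod 2) (hw : ∀ v, f v = 1 → eval v (affinePoly w) = 0) : w = 0 := by
  classical
  by_contra hne
  by_cases h : ∃ i, w (some i) ≠ 0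
  · obtain ⟨i, hi⟩ := h
    refine hf ⟨_, f, deg_affinePoly (Function.update w none (w none + 1)) i (by simpa using hi),
      fun v => ?_⟩
    rcases ZMod.eq_zero_or_eq_one_of_two (f v) with h0 | h1
    · simp [h0]
    · have := hw v h1
      rw [eval_affinePoly] at this ⊢
      simp only [Function.update_self, ne_eq, reduceCtorEq, not_false_eq_true,
        Function.update_of_ne]
      rw [h1, add_right_comm, this]
      simp
  · push Not at h
    have hnone : w none ≠ 0 := fun h0 => hne (funext fun j => by cases j <;> simp [h0, h])
    refine hf ⟨_, 0, deg_affinePoly 1 ⟨0, hm⟩ (by simp), fun v => ?_⟩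
    rcases ZMod.eq_zero_or_eq_one_of_two (f v) with h0 | h1
    · simp [h0]
    · have := hw v h1
      simp [eval_affinePoly, h, hnone] at this

theorem sum_mul_affineBasis_eq_zero {m : ℕ} (hm : 3 ≤ m) {f : BF m} (hdeg : deg f ≤ m - 3)
    (j k : Option (Fin m)) :
    ∑ v, f v * (eval v (affineBasis m j) * eval v (affineBasis m k)) = 0 := by
  have h := MvPolynomial.sum_eval_eq_zero (repPoly f * (affineBasis m j * affineBasis m k)) (by
    have h₁ := totalDegree_mul (repPoly f) (affineBasis m j * affineBasis m k)
    have h₂ := totalDegree_mul (affineBasis m j) (affineBasis m k)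
    have h₃ := totalDegree_affineBasis_le j
    have h₄ := totalDegree_affineBasis_le k
    have h₅ : (repPoly f).totalDegree ≤ m - 3 := hdeg
    rw [ZMod.card, Fintype.card_fin]
    omega)
  simpa only [map_mul, eval_repPoly] using h

/-- A matrix with linearly independent columns spanning a self-orthogonal space has at least
twice as many rows as columns. -/
theorem two_mul_card_le_of_transpose_mul_self_eq_zero {K ι κ : Type*} [Field K] [Fintype ι]
    [Fintype κ] [DecidableEq ι] [DecidableEq κ] (M : Matrix ι κ K)
    (hinj : Function.Injective M.mulVecLin) (horth : M.transpose * M = 0) :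
    2 * Fintype.card κ ≤ Fintype.card ι := by
  have h₁ : M.rank = Fintype.card κ := by
    rw [Matrix.rank, LinearMap.finrank_range_of_inj hinj, Module.finrank_fintype_fun_eq_card]
  have h₂ : LinearMap.range M.mulVecLin ≤ LinearMap.ker M.transpose.mulVecLin := by
    rw [LinearMap.range_le_ker_iff, ← Matrix.mulVecLin_mul, horth, Matrix.mulVecLin_zero]
  have h₃ := Submodule.finrank_mono h₂
  have h₄ := LinearMap.finrank_range_add_finrank_ker M.transpose.mulVecLin
  rw [Module.finrank_fintype_fun_eq_card] at h₄
  change M.transpose.rank + _ = _ at h₄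
  change M.rank ≤ _ at h₃
  rw [Matrix.rank_transpose] at h₄
  omega

/-- Theorem 3.1: a Boolean function on `m` variables of degree at most `m - 3` with no
affine (degree-1) factor has weight at least `2m + 2`. -/
theorem stmt0 (m : ℕ) (hm : 3 ≤ m) (f : BF m) (hdeg : deg f ≤ m - 3)
    (hnoaffine : ¬ ∃ (a g : BF m), deg a = 1 ∧ ∀ v : Fin m → ZMod 2, f v = a v * g v) :
    2 * m + 2 ≤ wt f := by
  classical
  let M : Matrix {v // f v = 1} (Option (Fin m)) (ZMod 2) :=
    fun v j => eval v.1 (affineBasis m j)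
  have hinj : Function.Injective M.mulVecLin := by
    rw [injective_iff_map_eq_zero]
    intro w hw
    refine eq_zero_of_eval_affinePoly_eq_zero (by omega) hnoaffine w fun v hv => ?_
    have : M.mulVec w ⟨v, hv⟩ = 0 := congrFun hw ⟨v, hv⟩
    simpa [M, Matrix.mulVec, dotProduct, affinePoly, mul_comm] using this
  have horth : M.transpose * M = 0 := by
    ext j k
    rw [Matrix.mul_apply, Matrix.zero_apply, ← sum_mul_affineBasis_eq_zero hm hdeg j k]
    have hsupp : ∀ v, f v * (eval v (affineBasis m j) * eval v (affineBasis m k)) =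
        if f v = 1 then eval v (affineBasis m j) * eval v (affineBasis m k) else 0 := by
      intro v
      rcases ZMod.eq_zero_or_eq_one_of_two (f v) with h | h <;> simp [h]
    simp_rw [hsupp]
    rw [← Finset.sum_filter]
    exact (Finset.sum_subtype _ (by simp)
      (fun v => eval v (affineBasis m j) * eval v (affineBasis m k))).symm
  have h := two_mul_card_le_of_transpose_mul_self_eq_zero M hinj horth
  rw [Fintype.card_option, Fintype.card_fin, Fintype.card_subtype] at h
  rw [mul_add_one] at h
  unfold wt
  convert h
end

section
/- Let p be a Boolean function on m variables X₁,…,X_m such that the coset p + RM(r,m) has minimum weight w, and let Y be a new variable. Then the coset Y·p + RM(r+1, m+1) has minimum weight w; that is, the minimum over q ∈ RM(r+1,m+1) of the weight of the (m+1)-variable Boolean function Y·p + q equals the minimum over q′ ∈ RM(r,m) of the weight of p + q′. -/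
open MvPolynomial

/-- Summing over `Fin (m + 1) → ZMod 2` by splitting on the last coordinate. -/
lemma sum_snoc {M : Type*} [AddCommMonoid M] {m : ℕ} (F : (Fin (m + 1) → ZMod 2) → M) :
    ∑ v, F v =
      ∑ v : Fin m → ZMod 2, F (Fin.snoc v 0) + ∑ v : Fin m → ZMod 2, F (Fin.snoc v 1) := by
  rw [← (Fin.snocEquiv fun _ : Fin (m + 1) => ZMod 2).sum_comp F, Fintype.sum_prod_type]
  exact Fin.sum_univ_two (fun a : Fin 2 => ∑ v : Fin m → ZMod 2, F (Fin.snoc v (a : ZMod 2)))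

lemma repPoly_eq_add_X_mul {m : ℕ} (q : BF (m + 1)) :
    repPoly q = rename Fin.castSucc (repPoly fun v => q (Fin.snoc v 0)) +
      X (Fin.last m) *
        rename Fin.castSucc (repPoly fun v => q (Fin.snoc v 0) + q (Fin.snoc v 1)) := by
  have hprod (v : Fin m → ZMod 2) (a : ZMod 2) :
      ∏ i, (X i + C ((Fin.snoc v a : Fin (m + 1) → ZMod 2) i + 1)) =
        rename Fin.castSucc (∏ i, (X i + C (v i + 1))) * (X (Fin.last m) + C (a + 1)) := by
    simp [Fin.prod_univ_castSucc, map_prod]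
  unfold repPoly
  rw [sum_snoc]
  simp only [map_sum, Finset.mul_sum, ← Finset.sum_add_distrib]
  refine Finset.sum_congr rfl fun v _ => ?_
  rw [hprod, hprod, show (1 + 1 : ZMod 2) = 0 from rfl, zero_add]
  simp only [smul_eq_C_mul, C_0, C_1, map_mul, map_add, rename_C]
  ring

lemma repPoly_zero {m : ℕ} : repPoly (fun _ : Fin m → ZMod 2 => 0) = 0 := by
  simp [repPoly]

lemma totalDegree_le_of_rename_add_X_mul {R : Type*} [CommSemiring R] {m r : ℕ}
    {A B : MvPolynomial (Fin m) R}
    (h : (rename Fin.castSucc A + X (Fin.last m) * rename Fin.castSucc B).totalDegree ≤ r + 1) :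
    B.totalDegree ≤ r := by
  refine Finset.sup_le fun s hs => ?_
  set t := s.mapDomain (Fin.castSucc : Fin m → Fin (m + 1)) with ht
  have hA : coeff (Finsupp.single (Fin.last m) 1 + t) (rename Fin.castSucc A) = 0 := by
    refine coeff_rename_eq_zero _ _ _ fun u hu => ?_
    have := DFunLike.congr_fun hu (Fin.last m)
    rw [Finsupp.mapDomain_of_notMem_range _ _ (by simp)] at this
    simp only [Finsupp.add_apply, Finsupp.single_eq_same] at this
    omega
  have hmem : Finsupp.single (Fin.last m) 1 + t ∈
      (rename Fin.castSucc A + X (Fin.last m) * rename Fin.castSucc B).support := by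
    rw [mem_support_iff, coeff_add, hA, coeff_X_mul, zero_add, ht,
      coeff_rename_mapDomain _ (Fin.castSucc_injective m)]
    exact mem_support_iff.mp hs
  have := (le_totalDegree hmem).trans h
  rw [Finsupp.sum_add_index' (by simp) (by simp), Finsupp.sum_single_index rfl, ht,
    Finsupp.sum_mapDomain_index (by simp) (by simp)] at this
  omega

/-- The derivative in the last variable lowers the degree. -/
lemma deg_add_snoc_le {m r : ℕ} {q : BF (m + 1)} (hq : deg q ≤ r + 1) :
    deg (fun v => q (Fin.snoc v 0) + q (Fin.snoc v 1)) ≤ r := by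
  rw [deg, repPoly_eq_add_X_mul] at hq
  exact totalDegree_le_of_rename_add_X_mul hq

lemma deg_last_mul_le {m r : ℕ} {q : BF m} (hq : deg q ≤ r) :
    deg (fun v : Fin (m + 1) → ZMod 2 => v (Fin.last m) * q fun i => v i.castSucc) ≤ r + 1 := by
  rw [deg, repPoly_eq_add_X_mul]
  simp only [Fin.snoc_last, Fin.snoc_castSucc, zero_mul, one_mul, zero_add, repPoly_zero, map_zero]
  refine (totalDegree_mul _ _).trans ?_
  rw [totalDegree_X, add_comm]
  exact Nat.add_le_add_right ((totalDegree_rename_le _ _).trans hq) 1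

lemma wt_eq_sum {m : ℕ} (f : BF m) : wt f = ∑ v, if f v = 1 then 1 else 0 := by
  simp [wt]

lemma wt_snoc {m : ℕ} (f : BF (m + 1)) :
    wt f = wt (fun v => f (Fin.snoc v 0)) + wt (fun v => f (Fin.snoc v 1)) := by
  simp only [wt_eq_sum]
  exact sum_snoc _

lemma wt_add_le {m : ℕ} (f g : BF m) : wt (f + g) ≤ wt f + wt g := by
  simp only [wt_eq_sum, ← Finset.sum_add_distrib, Pi.add_apply]
  refine Finset.sum_le_sum fun v _ => ?_
  have key : ∀ a b : ZMod 2, (if a + b = 1 then 1 else 0) ≤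
      (if a = 1 then 1 else 0) + if b = 1 then 1 else 0 := by decide
  exact key _ _

lemma wt_last_mul {m : ℕ} (f : BF m) :
    wt (fun v : Fin (m + 1) → ZMod 2 => v (Fin.last m) * f fun i => v i.castSucc) = wt f := by
  rw [wt_snoc]
  simp [wt]

lemma distRM_le {m r : ℕ} (f : BF m) {p : BF m} (hp : deg p ≤ r) : distRM m r f ≤ wt (f + p) :=
  Nat.sInf_le ⟨p, hp, rfl⟩

lemma exists_wt_eq_distRM {m : ℕ} (r : ℕ) (f : BF m) :
    ∃ p : BF m, deg p ≤ r ∧ wt (f + p) = distRM m r f :=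
  Nat.sInf_mem (s := {w | ∃ p : BF m, deg p ≤ r ∧ wt (f + p) = w})
    ⟨_, fun _ => 0, by simp [deg, repPoly_zero], rfl⟩

/-- Proposition 2.1: if the coset `p + RM(r, m)` has minimum weight `w` and `Y` is a new
variable, then the coset `Y·p + RM(r+1, m+1)` has minimum weight `w`. -/
theorem stmt2 (m r w : ℕ) (p : BF m) (h : distRM m r p = w) :
    distRM (m + 1) (r + 1)
      (fun v : Fin (m + 1) → ZMod 2 => v (Fin.last m) * p (fun i => v i.castSucc)) = w := by
  subst h
  refine le_antisymm ?_ ?_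
  · obtain ⟨q, hq, hw⟩ := exists_wt_eq_distRM r p
    rw [← hw, ← wt_last_mul (p + q)]
    refine (distRM_le _ (deg_last_mul_le hq)).trans_eq (congrArg wt ?_)
    funext v
    simp [mul_add]
  · obtain ⟨q, hq, hw⟩ := exists_wt_eq_distRM (r + 1)
      (fun v : Fin (m + 1) → ZMod 2 => v (Fin.last m) * p fun i => v i.castSucc)
    rw [← hw, wt_snoc]
    refine (distRM_le p (deg_add_snoc_le hq)).trans ?_
    refine le_trans (le_of_eq (congrArg wt ?_)) (wt_add_le _ _)
    funext v
    simp only [Pi.add_apply, Fin.snoc_last, Fin.snoc_castSucc]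
    ring
end

section
/- The covering radius of RM(5,9) in RM(6,9) is at least 28; that is, there exists a Boolean function on 9 variables of degree at most 6 whose distance to RM(5,9) is at least 28. -/
open MvPolynomial

/-- The bilinear multiplication of the field `𝔽₈ = 𝔽₂[ζ]/(ζ³ + ζ + 1)` in the basis `1, ζ, ζ²`. -/
def mulGF8 (x y : Fin 3 → ZMod 2) : Fin 3 → ZMod 2 :=
  ![x 0 * y 0 + x 1 * y 2 + x 2 * y 1,
    x 0 * y 1 + x 1 * y 0 + x 1 * y 2 + x 2 * y 1 + x 2 * y 2,
    x 0 * y 2 + x 1 * y 1 + x 2 * y 0 + x 2 * y 2]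

/-- The three blocks of coordinates of a vector in `𝔽₂⁹`, the `n`-th one starting at `3 * n`. -/
def block (n : Fin 3) (v : Fin 9 → ZMod 2) : Fin 3 → ZMod 2 :=
  fun i => v (finProdFinEquiv (n, i))

/-- The index triples `i < j < k` on which the alternating form `altForm` is `1`. -/
def triples : Finset (Fin 9 × Fin 9 × Fin 9) :=
  {(0, 1, 2), (0, 3, 8), (0, 5, 6), (2, 3, 6), (0, 4, 7), (1, 3, 7), (1, 4, 6), (0, 5, 8),
    (2, 3, 8), (2, 5, 6), (1, 4, 8), (1, 5, 7), (2, 4, 7), (1, 5, 8), (2, 4, 8), (2, 5, 7),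
    (2, 5, 8)}

/-- The permanent (equal to the determinant in characteristic two) of the columns `i, j, k` of
the matrix with rows `a, b, d`. -/
def minorForm (a b d : Fin 9 → ZMod 2) (i j k : Fin 9) : ZMod 2 :=
  a i * (b j * d k + b k * d j) + a j * (b i * d k + b k * d i) + a k * (b i * d j + b j * d i)

/-- An alternating trilinear form on `𝔽₂⁹`. -/
def altForm (a b d : Fin 9 → ZMod 2) : ZMod 2 :=
  ∑ t ∈ triples, minorForm a b d t.1 t.2.1 t.2.2

/-- The Boolean function of degree six whose monomials are complementary to `triples`. -/
def sextic : BF 9 := fun v => ∑ t ∈ triples, ∏ s ∈ {t.1, t.2.1, t.2.2}ᶜ, v s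

theorem altForm_eq (a b d : Fin 9 → ZMod 2) :
    altForm a b d =
      mulGF8 (block 0 a) (mulGF8 (block 1 b) (block 2 d) + mulGF8 (block 2 b) (block 1 d)) 2 +
      mulGF8 (block 1 a) (mulGF8 (block 0 b) (block 2 d) + mulGF8 (block 2 b) (block 0 d)) 2 +
      mulGF8 (block 2 a) (mulGF8 (block 0 b) (block 1 d) + mulGF8 (block 1 b) (block 0 d)) 2 +
      minorForm a b d 0 1 2 := by
  have h0 (v : Fin 9 → ZMod 2) : block 0 v = ![v 0, v 1, v 2] := by
    ext i; fin_cases i <;> rfl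
  have h1 (v : Fin 9 → ZMod 2) : block 1 v = ![v 3, v 4, v 5] := by
    ext i; fin_cases i <;> rfl
  have h2 (v : Fin 9 → ZMod 2) : block 2 v = ![v 6, v 7, v 8] := by
    ext i; fin_cases i <;> rfl
  simp only [altForm, triples, h0, h1, h2]
  repeat rw [Finset.sum_insert (by decide)]
  rw [Finset.sum_singleton]
  simp only [minorForm, mulGF8, Pi.add_apply, Matrix.cons_val]
  ring

theorem altForm_zero_right (a b : Fin 9 → ZMod 2) : altForm a b 0 = 0 := by
  simp [altForm, minorForm]

theorem altForm_add_right (a b d e : Fin 9 → ZMod 2) :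
    altForm a b (d + e) = altForm a b d + altForm a b e := by
  simp only [altForm, ← Finset.sum_add_distrib]
  refine Finset.sum_congr rfl fun t _ => ?_
  simp only [minorForm, Pi.add_apply]
  ring

theorem repPoly_mem_restrictDegree {m : ℕ} (f : BF m) :
    repPoly f ∈ restrictDegree (Fin m) (ZMod 2) 1 := by
  refine Submodule.sum_mem _ fun v _ => Submodule.smul_mem _ _ ?_
  rw [mem_restrictDegree_iff_sup]
  intro n
  rw [← degreeOf_def]
  refine (degreeOf_prod_le n _ _).trans ?_
  calc ∑ i, degreeOf n (X i + C (v i + 1) : MvPolynomial (Fin m) (ZMod 2))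
      ≤ ∑ i, if n = i then 1 else 0 := by
        refine Finset.sum_le_sum fun i _ => (degreeOf_add_le _ _ _).trans ?_
        rw [degreeOf_X, degreeOf_C]
        simp
    _ ≤ 1 := by simp

theorem repPoly_eq_of_eval {m : ℕ} {f : BF m} {F : MvPolynomial (Fin m) (ZMod 2)}
    (hF : F ∈ restrictDegree (Fin m) (ZMod 2) 1) (h : ∀ v, eval v F = f v) : repPoly f = F := by
  rw [← sub_eq_zero]
  refine eq_zero_of_eval_eq_zero _ _ _ (fun v => ?_) ?_
  · rw [map_sub, eval_repPoly, h, sub_self]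
  · rw [ZMod.card]
    exact Submodule.sub_mem _ (repPoly_mem_restrictDegree f) hF

theorem deg_sextic_le : deg sextic ≤ 6 := by
  have hF : repPoly sextic = ∑ t ∈ triples, ∏ s ∈ {t.1, t.2.1, t.2.2}ᶜ, X s := by
    refine repPoly_eq_of_eval (Submodule.sum_mem _ fun t _ => ?_) fun v => by
      simp [sextic, map_sum, map_prod]
    rw [mem_restrictDegree_iff_sup]
    intro n
    rw [← degreeOf_def]
    refine (degreeOf_prod_le n _ _).trans ?_
    simp only [degreeOf_X]
    rw [Finset.sum_ite_eq]
    split_ifs <;> simp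
  rw [deg, hF]
  refine totalDegree_finsetSum_le fun t ht => (totalDegree_finsetProd _ _).trans ?_
  simp only [totalDegree_X, Finset.sum_const, smul_eq_mul, mul_one]
  revert t
  decide +kernel

/-- A Boolean function of degree at most five is orthogonal to all products of three affine
functions on `𝔽₂⁹`. -/
theorem sum_mul_affine_eq_zero {p : BF 9} (hp : deg p ≤ 5) (a b d : Fin 9 → ZMod 2)
    (α β γ : ZMod 2) :
    ∑ v, p v * ((a ⬝ᵥ v + α) * (b ⬝ᵥ v + β) * (d ⬝ᵥ v + γ)) = 0 := by
  let A (a : Fin 9 → ZMod 2) (α : ZMod 2) : MvPolynomial (Fin 9) (ZMod 2) :=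
    ∑ i, C (a i) * X i + C α
  have hA (a α) : (A a α).totalDegree ≤ 1 := by
    refine (totalDegree_add _ _).trans (max_le (totalDegree_finsetSum_le fun i _ => ?_) (by simp))
    exact (totalDegree_mul _ _).trans (by simp)
  have hev (a α v) : eval v (A a α) = a ⬝ᵥ v + α := by
    simp [A, map_sum, dotProduct]
  have := sum_eval_eq_zero (repPoly p * (A a α * A b β * A d γ)) (by
    rw [ZMod.card, Fintype.card_fin]
    have h1 := totalDegree_mul (repPoly p) (A a α * A b β * A d γ)
    have h2 := totalDegree_mul (A a α * A b β) (A d γ)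
    have h3 := totalDegree_mul (A a α) (A b β)
    have := hA a α
    have := hA b β
    have := hA d γ
    unfold deg at hp
    omega)
  simpa only [map_mul, hev, eval_repPoly] using this

theorem sum_prod_compl_mul_affine {i j k : Fin 9} (hij : i ≠ j) (hik : i ≠ k) (hjk : j ≠ k)
    (a b d : Fin 9 → ZMod 2) (α β γ : ZMod 2) :
    ∑ v : Fin 9 → ZMod 2, (∏ s ∈ {i, j, k}ᶜ, v s) *
      ((a ⬝ᵥ v + α) * (b ⬝ᵥ v + β) * (d ⬝ᵥ v + γ)) = minorForm a b d i j k := by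
  let φ (y : ZMod 2 × ZMod 2 × ZMod 2) : Fin 9 → ZMod 2 :=
    fun s => if s = i then y.1 else if s = j then y.2.1 else if s = k then y.2.2 else 1
  have hφi (y) : φ y i = y.1 := by simp [φ]
  have hφj (y) : φ y j = y.2.1 := by simp [φ, hij.symm]
  have hφk (y) : φ y k = y.2.2 := by simp [φ, hik.symm, hjk.symm]
  have hφ (y s) (hs : s ∈ ({i, j, k}ᶜ : Finset (Fin 9))) : φ y s = 1 := by
    simp only [Finset.mem_compl, Finset.mem_insert, Finset.mem_singleton, not_or] at hs
    simp [φ, hs]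
  have hdot (a : Fin 9 → ZMod 2) (y) : a ⬝ᵥ φ y =
      a i * y.1 + a j * y.2.1 + a k * y.2.2 + ∑ s ∈ {i, j, k}ᶜ, a s := by
    rw [dotProduct, ← Finset.sum_add_sum_compl {i, j, k}, Finset.sum_insert (by simp [hij, hik]),
      Finset.sum_pair hjk, hφi, hφj, hφk, ← add_assoc]
    refine congrArg _ (Finset.sum_congr rfl fun s hs => by rw [hφ y s hs, mul_one])
  rw [← Finset.sum_subset (Finset.subset_univ (Finset.univ.image φ)),
    Finset.sum_image fun y _ z _ h => ?_]
  · simp only [Finset.prod_congr rfl (hφ _), Finset.prod_const_one, one_mul, hdot,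
      Fintype.sum_prod_type]
    generalize ∑ s ∈ {i, j, k}ᶜ, a s = A
    generalize ∑ s ∈ {i, j, k}ᶜ, b s = B
    generalize ∑ s ∈ {i, j, k}ᶜ, d s = D
    have hu (F : ZMod 2 → ZMod 2) : ∑ x, F x = F 0 + F 1 := Fin.sum_univ_two F
    simp only [hu, minorForm]
    ring_nf
    reduce_mod_char
  · ext
    · rw [← hφi y, ← hφi z, h]
    · rw [← hφj y, ← hφj z, h]
    · rw [← hφk y, ← hφk z, h]
  · intro v _ hv
    have : ∃ s ∈ ({i, j, k}ᶜ : Finset (Fin 9)), v s ≠ 1 := by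
      by_contra! h
      refine hv (Finset.mem_image.mpr ⟨(v i, v j, v k), Finset.mem_univ _, ?_⟩)
      ext s
      by_cases hs : s ∈ ({i, j, k}ᶜ : Finset (Fin 9))
      · rw [hφ _ s hs, h s hs]
      · simp only [Finset.mem_compl, Finset.mem_insert, Finset.mem_singleton, not_not] at hs
        rcases hs with rfl | rfl | rfl
        · rw [hφi]
        · rw [hφj]
        · rw [hφk]
    obtain ⟨s, hs, hvs⟩ := this
    rw [Finset.prod_eq_zero hs, zero_mul]
    revert hvs
    generalize v s = x
    revert x
    decide

theorem sum_sextic_mul_affine (a b d : Fin 9 → ZMod 2) (α β γ : ZMod 2) :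
    ∑ v, sextic v * ((a ⬝ᵥ v + α) * (b ⬝ᵥ v + β) * (d ⬝ᵥ v + γ)) = altForm a b d := by
  simp only [sextic, Finset.sum_mul]
  rw [Finset.sum_comm]
  refine Finset.sum_congr rfl fun t ht => ?_
  have h : ∀ t ∈ triples, t.1 ≠ t.2.1 ∧ t.1 ≠ t.2.2 ∧ t.2.1 ≠ t.2.2 := by
    decide +kernel
  obtain ⟨h1, h2, h3⟩ := h t ht
  exact sum_prod_compl_mul_affine h1 h2 h3 a b d α β γ

theorem mulGF8_comm (x y : Fin 3 → ZMod 2) : mulGF8 x y = mulGF8 y x := by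
  ext i
  fin_cases i <;> simp [mulGF8] <;> ring

theorem mulGF8_assoc (x y z : Fin 3 → ZMod 2) :
    mulGF8 (mulGF8 x y) z = mulGF8 x (mulGF8 y z) := by
  ext i
  fin_cases i <;> simp [mulGF8] <;> ring_nf

theorem mulGF8_add (x y z : Fin 3 → ZMod 2) : mulGF8 x (y + z) = mulGF8 x y + mulGF8 x z := by
  ext i
  fin_cases i <;> simp [mulGF8] <;> ring

theorem add_mulGF8 (x y z : Fin 3 → ZMod 2) : mulGF8 (x + y) z = mulGF8 x z + mulGF8 y z := by
  rw [mulGF8_comm, mulGF8_add, mulGF8_comm z, mulGF8_comm z]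

theorem mulGF8_zero (x : Fin 3 → ZMod 2) : mulGF8 x 0 = 0 := by
  ext i
  fin_cases i <;> simp [mulGF8]

theorem zero_mulGF8 (x : Fin 3 → ZMod 2) : mulGF8 0 x = 0 := by
  rw [mulGF8_comm, mulGF8_zero]

theorem eq_zero_of_mulGF8_eq_zero :
    ∀ {x y : Fin 3 → ZMod 2}, x ≠ 0 → mulGF8 x y = 0 → y = 0 := by
  decide +kernel

theorem eq_zero_of_forall_mulGF8 :
    ∀ {x : Fin 3 → ZMod 2}, (∀ y, mulGF8 x y 2 = 0) → x = 0 := by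
  decide +kernel

/-- The vector with the three given blocks. -/
def ofBlocks (x y z : Fin 3 → ZMod 2) : Fin 9 → ZMod 2 :=
  ![x 0, x 1, x 2, y 0, y 1, y 2, z 0, z 1, z 2]

theorem block_zero_ofBlocks (x y z : Fin 3 → ZMod 2) : block 0 (ofBlocks x y z) = x := by
  ext i; fin_cases i <;> rfl

theorem block_one_ofBlocks (x y z : Fin 3 → ZMod 2) : block 1 (ofBlocks x y z) = y := by
  ext i; fin_cases i <;> rfl

theorem block_two_ofBlocks (x y z : Fin 3 → ZMod 2) : block 2 (ofBlocks x y z) = z := by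
  ext i; fin_cases i <;> rfl

theorem ofBlocks_block (v : Fin 9 → ZMod 2) :
    ofBlocks (block 0 v) (block 1 v) (block 2 v) = v := by
  ext i; fin_cases i <;> rfl

theorem eq_zero_of_blocks {v : Fin 9 → ZMod 2} (h0 : block 0 v = 0) (h1 : block 1 v = 0)
    (h2 : block 2 v = 0) : v = 0 := by
  rw [← ofBlocks_block v, h0, h1, h2]
  ext i; fin_cases i <;> rfl

theorem minorForm_eq_zero_of_block {a b d : Fin 9 → ZMod 2} (h : block 0 d = 0) :
    minorForm a b d 0 1 2 = 0 := by
  have h0 : d 0 = 0 := congrFun h 0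
  have h1 : d 1 = 0 := congrFun h 1
  have h2 : d 2 = 0 := congrFun h 2
  simp [minorForm, h0, h1, h2]

theorem altForm_ofBlocks_one (a b : Fin 9 → ZMod 2) (y : Fin 3 → ZMod 2) :
    altForm a b (ofBlocks 0 y 0) = mulGF8
      (mulGF8 (block 0 a) (block 2 b) + mulGF8 (block 2 a) (block 0 b)) y 2 := by
  rw [altForm_eq, minorForm_eq_zero_of_block (block_zero_ofBlocks _ _ _), block_zero_ofBlocks,
    block_one_ofBlocks, block_two_ofBlocks]
  simp only [mulGF8_zero, zero_add, add_zero, Pi.zero_apply]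
  rw [add_mulGF8, mulGF8_assoc, mulGF8_assoc]
  rfl

theorem altForm_ofBlocks_two (a b : Fin 9 → ZMod 2) (z : Fin 3 → ZMod 2) :
    altForm a b (ofBlocks 0 0 z) = mulGF8
      (mulGF8 (block 0 a) (block 1 b) + mulGF8 (block 1 a) (block 0 b)) z 2 := by
  rw [altForm_eq, minorForm_eq_zero_of_block (block_zero_ofBlocks _ _ _), block_zero_ofBlocks,
    block_one_ofBlocks, block_two_ofBlocks]
  simp only [mulGF8_zero, add_zero, Pi.zero_apply]
  rw [add_mulGF8, mulGF8_assoc, mulGF8_assoc]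
  rfl

theorem altForm_ofBlocks_zero (a b : Fin 9 → ZMod 2) (x : Fin 3 → ZMod 2) :
    altForm a b (ofBlocks x 0 0) = mulGF8
      (mulGF8 (block 1 a) (block 2 b) + mulGF8 (block 2 a) (block 1 b)) x 2 +
      minorForm a b (ofBlocks x 0 0) 0 1 2 := by
  rw [altForm_eq, block_zero_ofBlocks, block_one_ofBlocks, block_two_ofBlocks]
  simp only [mulGF8_zero, zero_add, add_zero, Pi.zero_apply]
  rw [add_mulGF8, mulGF8_assoc, mulGF8_assoc]
  rfl

theorem mulGF8_block_add_eq_zero_of_altForm {a b : Fin 9 → ZMod 2}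
    (h : ∀ d, block 0 d = 0 → altForm a b d = 0) :
    mulGF8 (block 0 a) (block 1 b) + mulGF8 (block 1 a) (block 0 b) = 0 ∧
      mulGF8 (block 0 a) (block 2 b) + mulGF8 (block 2 a) (block 0 b) = 0 :=
  ⟨eq_zero_of_forall_mulGF8 fun z => by
      rw [← altForm_ofBlocks_two]; exact h _ (block_zero_ofBlocks _ _ _),
    eq_zero_of_forall_mulGF8 fun y => by
      rw [← altForm_ofBlocks_one]; exact h _ (block_zero_ofBlocks _ _ _)⟩

/-- A vector outside the six-dimensional singular subspace spans its own radical. -/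
theorem exists_radical_eq_zero {l : Fin 9 → ZMod 2} (hl : block 0 l ≠ 0) :
    ∃ s : Finset (Fin 9), s.card ≤ 1 ∧
      ∀ m, (∀ d, altForm l m d = 0) → (∀ i ∈ s, m i = 0) → m = 0 := by
  obtain ⟨t, ht⟩ := Function.ne_iff.mp hl
  refine ⟨{finProdFinEquiv ((0 : Fin 3), t)}, (Finset.card_singleton _).le, fun m hm hmt => ?_⟩
  simp only [Finset.mem_singleton, forall_eq] at hmt
  obtain ⟨h1, h2⟩ := mulGF8_block_add_eq_zero_of_altForm fun d _ => hm d
  have h3 : mulGF8 (block 1 l) (block 2 m) + mulGF8 (block 2 l) (block 1 m) = 0 := by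
    refine eq_zero_of_mulGF8_eq_zero hl ?_
    have h1' := congrArg (mulGF8 (block 2 l)) h1
    have h2' := congrArg (mulGF8 (block 1 l)) h2
    rw [mulGF8_zero, mulGF8_add, ← mulGF8_assoc, ← mulGF8_assoc] at h1' h2'
    rw [mulGF8_add, ← mulGF8_assoc, ← mulGF8_assoc, mulGF8_comm (block 0 l),
      mulGF8_comm (block 0 l)]
    rw [mulGF8_comm (block 2 l) (block 1 l)] at h1'
    rw [CharTwo.add_eq_zero] at h1' h2' ⊢
    rw [h1', h2']
  have h4 (x : Fin 3 → ZMod 2) : minorForm l m (ofBlocks x 0 0) 0 1 2 = 0 := by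
    have := hm (ofBlocks x 0 0)
    rwa [altForm_ofBlocks_zero, h3, zero_mulGF8, Pi.zero_apply, zero_add] at this
  have hm0 : block 0 m = 0 := by
    have key : ∀ x y : Fin 3 → ZMod 2, ∀ t, x t ≠ 0 → y t = 0 →
        x 0 * y 1 + x 1 * y 0 = 0 ∧ x 0 * y 2 + x 2 * y 0 = 0 ∧ x 1 * y 2 + x 2 * y 1 = 0 →
        y = 0 := by
      decide +kernel
    refine key (block 0 l) _ t ht hmt ⟨?_, ?_, ?_⟩
    · change l 0 * m 1 + l 1 * m 0 = 0
      simpa [minorForm, ofBlocks] using h4 ![0, 0, 1]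
    · change l 0 * m 2 + l 2 * m 0 = 0
      simpa [minorForm, ofBlocks] using h4 ![0, 1, 0]
    · change l 1 * m 2 + l 2 * m 1 = 0
      simpa [minorForm, ofBlocks] using h4 ![1, 0, 0]
  rw [hm0, mulGF8_zero, add_zero] at h1 h2
  exact eq_zero_of_blocks hm0 (eq_zero_of_mulGF8_eq_zero hl h1) (eq_zero_of_mulGF8_eq_zero hl h2)

/-- A nonzero vector of the singular subspace has a radical of dimension at most three. -/
theorem exists_radical_eq_zero_of_block {l : Fin 9 → ZMod 2} (hl : l ≠ 0)
    (hl0 : block 0 l = 0) :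
    ∃ s : Finset (Fin 9), s.card ≤ 3 ∧
      ∀ m, (∀ d, altForm l m d = 0) → (∀ i ∈ s, m i = 0) → m = 0 := by
  suffices ∃ n, ∀ m, (∀ d, altForm l m d = 0) → block n m = 0 → m = 0 by
    obtain ⟨n, hn⟩ := this
    refine ⟨Finset.univ.image fun i : Fin 3 => finProdFinEquiv (n, i), Finset.card_image_le,
      fun m hm h => hn m hm (funext fun i => h _ (Finset.mem_image_of_mem _ (Finset.mem_univ i)))⟩
  have hrad (m) (hm : ∀ d, altForm l m d = 0) : block 0 m = 0 ∧
      mulGF8 (block 1 l) (block 2 m) + mulGF8 (block 2 l) (block 1 m) = 0 := by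
    obtain ⟨h1, h2⟩ := mulGF8_block_add_eq_zero_of_altForm fun d _ => hm d
    rw [hl0, zero_mulGF8, zero_add] at h1 h2
    have hm0 : block 0 m = 0 := by
      by_cases h : block 1 l = 0
      · exact eq_zero_of_mulGF8_eq_zero (fun h' => hl (eq_zero_of_blocks hl0 h h')) h2
      · exact eq_zero_of_mulGF8_eq_zero h h1
    refine ⟨hm0, eq_zero_of_forall_mulGF8 fun x => ?_⟩
    have hmin : minorForm l m (ofBlocks x 0 0) 0 1 2 = 0 := by
      have e0 : l 0 = 0 := congrFun hl0 0
      have e1 : l 1 = 0 := congrFun hl0 1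
      have e2 : l 2 = 0 := congrFun hl0 2
      simp [minorForm, e0, e1, e2]
    simpa only [altForm_ofBlocks_zero, hmin, add_zero] using hm (ofBlocks x 0 0)
  by_cases h : block 1 l = 0
  · refine ⟨2, fun m hm h2 => ?_⟩
    obtain ⟨h0, h3⟩ := hrad m hm
    rw [h, zero_mulGF8, zero_add] at h3
    exact eq_zero_of_blocks h0
      (eq_zero_of_mulGF8_eq_zero (fun h' => hl (eq_zero_of_blocks hl0 h h')) h3) h2
  · refine ⟨1, fun m hm h1 => ?_⟩
    obtain ⟨h0, h3⟩ := hrad m hm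
    rw [h1, mulGF8_zero, add_zero] at h3
    exact eq_zero_of_blocks h0 h1 (eq_zero_of_mulGF8_eq_zero h h3)

/-- The moments of order at most three of a finite set of vectors are those of `sextic`. -/
def HasMoments (S : Finset (Fin 9 → ZMod 2)) : Prop :=
  ∀ (a b d : Fin 9 → ZMod 2) (α β γ : ZMod 2),
    ∑ v ∈ S, (a ⬝ᵥ v + α) * (b ⬝ᵥ v + β) * (d ⬝ᵥ v + γ) = altForm a b d

theorem hasMoments_support {p : BF 9} (hp : deg p ≤ 5) :
    HasMoments (Finset.univ.filter fun v => (sextic + p) v = 1) := by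
  intro a b d α β γ
  rw [← sum_sextic_mul_affine a b d α β γ, ← add_zero (∑ v, sextic v * _),
    ← sum_mul_affine_eq_zero hp a b d α β γ, ← Finset.sum_add_distrib, Finset.sum_filter]
  refine Finset.sum_congr rfl fun v _ => ?_
  rw [← add_mul, Pi.add_apply]
  generalize sextic v + p v = x
  have : x = 0 ∨ x = 1 := by
    revert x
    decide
  rcases this with rfl | rfl <;> simp

theorem HasMoments.image_add {S : Finset (Fin 9 → ZMod 2)} (hS : HasMoments S)
    (t : Fin 9 → ZMod 2) : HasMoments (S.image (· + t)) := by
  intro a b d α β γ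
  rw [Finset.sum_image fun _ _ _ _ h => add_right_cancel h,
    ← hS a b d (a ⬝ᵥ t + α) (b ⬝ᵥ t + β) (d ⬝ᵥ t + γ)]
  simp only [dotProduct_add, add_assoc]

theorem HasMoments.natCast_card_filter {S : Finset (Fin 9 → ZMod 2)} (hS : HasMoments S)
    (a b d : Fin 9 → ZMod 2) (α β γ : ZMod 2) :
    ((S.filter fun v => a ⬝ᵥ v = α ∧ b ⬝ᵥ v = β ∧ d ⬝ᵥ v = γ).card : ZMod 2) =
      altForm a b d := by
  rw [← hS a b d (α + 1) (β + 1) (γ + 1), Finset.card_filter, Nat.cast_sum]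
  refine Finset.sum_congr rfl fun v _ => ?_
  generalize a ⬝ᵥ v = x
  generalize b ⬝ᵥ v = y
  generalize d ⬝ᵥ v = z
  revert x y z α β γ
  decide +kernel

theorem HasMoments.even_card_filter₂ {S : Finset (Fin 9 → ZMod 2)} (hS : HasMoments S)
    (a b : Fin 9 → ZMod 2) (α β : ZMod 2) :
    Even (S.filter fun v => a ⬝ᵥ v = α ∧ b ⬝ᵥ v = β).card := by
  have := hS.natCast_card_filter a b 0 α β 0
  simp only [zero_dotProduct, and_true, altForm_zero_right] at this
  exact (ZMod.natCast_eq_zero_iff_even).mp this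

theorem HasMoments.even_card_filter {S : Finset (Fin 9 → ZMod 2)} (hS : HasMoments S)
    (a : Fin 9 → ZMod 2) (α : ZMod 2) : Even (S.filter fun v => a ⬝ᵥ v = α).card := by
  simpa using hS.even_card_filter₂ a 0 α 0

theorem HasMoments.even_card {S : Finset (Fin 9 → ZMod 2)} (hS : HasMoments S) :
    Even S.card := by
  simpa using hS.even_card_filter 0 0

/-- A half of a set with the moments of `sextic` is large if the form `altForm l` has a small
radical. -/
theorem HasMoments.le_card_filter_add {S : Finset (Fin 9 → ZMod 2)} (hS : HasMoments S)
    {l : Fin 9 → ZMod 2} (ε : ZMod 2) {s : Finset (Fin 9)} (hs : s.card < 9)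
    (hl : ∀ m, (∀ d, altForm l m d = 0) → (∀ i ∈ s, m i = 0) → m = 0) :
    10 ≤ (S.filter fun v => l ⬝ᵥ v = ε).card + s.card := by
  set A := S.filter fun v => l ⬝ᵥ v = ε with hA
  have hrad {m : Fin 9 → ZMod 2} {β : ZMod 2} (h : ∀ v ∈ A, m ⬝ᵥ v + β = 0)
      (d : Fin 9 → ZMod 2) : altForm l m d = 0 := by
    rw [← hS l m d (ε + 1) β 0]
    refine Finset.sum_eq_zero fun v hv => ?_
    by_cases hlv : l ⬝ᵥ v = ε
    · rw [h v (Finset.mem_filter.mpr ⟨hv, hlv⟩)]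
      simp
    · have key : ∀ x y : ZMod 2, x ≠ y → x + (y + 1) = 0 := by decide
      rw [key _ _ hlv]
      simp
  have hne : A.Nonempty := by
    by_contra hA0
    rw [Finset.not_nonempty_iff_eq_empty] at hA0
    have hinj : Function.Injective fun (m : Fin 9 → ZMod 2) (i : s) => m i := by
      intro m m' h
      rw [← sub_eq_zero]
      refine hl _ (hrad (β := 0) (by simp [hA0])) fun i hi => ?_
      exact sub_eq_zero.mpr (congrFun h ⟨i, hi⟩)
    have := Fintype.card_le_of_injective _ hinj
    simp only [Fintype.card_fun, Fintype.card_fin, ZMod.card, Fintype.card_coe] at this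
    exact absurd ((Nat.pow_le_pow_iff_right (by norm_num)).mp this) (by omega)
  have hinj : Function.Injective fun (x : (Fin 9 → ZMod 2) × ZMod 2) =>
      ((fun v : A => x.1 ⬝ᵥ (v : Fin 9 → ZMod 2) + x.2), fun i : s => x.1 i) := by
    rintro ⟨m, β⟩ ⟨m', β'⟩ h
    obtain ⟨h1, h2⟩ := Prod.ext_iff.mp h
    have h1' (v) (hv : v ∈ A) : m ⬝ᵥ v + β = m' ⬝ᵥ v + β' := congrFun h1 ⟨v, hv⟩
    have hmm : m = m' := by
      rw [← sub_eq_zero]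
      refine hl _ (hrad (β := β - β') fun v hv => ?_) fun i hi => ?_
      · rw [sub_dotProduct]
        linear_combination h1' v hv
      · exact sub_eq_zero.mpr (congrFun h2 ⟨i, hi⟩)
    subst hmm
    obtain ⟨v, hv⟩ := hne
    rw [add_left_cancel (h1' v hv)]
  have := Fintype.card_le_of_injective _ hinj
  simp only [Fintype.card_prod, Fintype.card_fun, Fintype.card_fin, ZMod.card,
    Fintype.card_coe] at this
  rw [← pow_succ, ← pow_add] at this
  exact (Nat.pow_le_pow_iff_right (by norm_num)).mp this

theorem HasMoments.ten_le_card_filter {S : Finset (Fin 9 → ZMod 2)} (hS : HasMoments S)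
    {l : Fin 9 → ZMod 2} (hl : block 0 l ≠ 0) (ε : ZMod 2) :
    10 ≤ (S.filter fun v => l ⬝ᵥ v = ε).card := by
  obtain ⟨s, hs, h⟩ := exists_radical_eq_zero hl
  have h1 := hS.le_card_filter_add ε (by omega) h
  obtain ⟨r, hr⟩ := hS.even_card_filter l ε
  omega

theorem HasMoments.eight_le_card_filter {S : Finset (Fin 9 → ZMod 2)} (hS : HasMoments S)
    {l : Fin 9 → ZMod 2} (hl : l ≠ 0) (ε : ZMod 2) :
    8 ≤ (S.filter fun v => l ⬝ᵥ v = ε).card := by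
  by_cases hl0 : block 0 l = 0
  · obtain ⟨s, hs, h⟩ := exists_radical_eq_zero_of_block hl hl0
    have h1 := hS.le_card_filter_add ε (by omega) h
    obtain ⟨r, hr⟩ := hS.even_card_filter l ε
    omega
  · exact (by norm_num : 8 ≤ 10).trans (hS.ten_le_card_filter hl0 ε)

/-- The nontrivial additive character of `𝔽₂`. -/
def sgn (x : ZMod 2) : ℤ := if x = 0 then 1 else -1

theorem sgn_zero : sgn 0 = 1 := rfl

theorem sgn_add : ∀ x y, sgn (x + y) = sgn x * sgn y := by
  decide

/-- The character sum of `S` at the linear form `l`. -/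
def charSum (S : Finset (Fin 9 → ZMod 2)) (l : Fin 9 → ZMod 2) : ℤ :=
  ∑ v ∈ S, sgn (l ⬝ᵥ v)

theorem charSum_zero (S : Finset (Fin 9 → ZMod 2)) : charSum S 0 = S.card := by
  simp [charSum, sgn]

theorem charSum_eq (S : Finset (Fin 9 → ZMod 2)) (l : Fin 9 → ZMod 2) :
    charSum S l = (S.filter fun v => l ⬝ᵥ v = 0).card - (S.filter fun v => l ⬝ᵥ v = 1).card := by
  rw [charSum, Finset.card_filter, Finset.card_filter, Nat.cast_sum, Nat.cast_sum,
    ← Finset.sum_sub_distrib]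
  refine Finset.sum_congr rfl fun v _ => ?_
  generalize l ⬝ᵥ v = x
  revert x
  decide

theorem card_eq_card_filter_add (S : Finset (Fin 9 → ZMod 2)) (l : Fin 9 → ZMod 2) :
    S.card = (S.filter fun v => l ⬝ᵥ v = 0).card + (S.filter fun v => l ⬝ᵥ v = 1).card := by
  rw [Finset.card_eq_sum_ones, Finset.card_filter, Finset.card_filter, ← Finset.sum_add_distrib]
  refine Finset.sum_congr rfl fun v _ => ?_
  generalize l ⬝ᵥ v = x
  revert x
  decide

theorem charSum_image_add (S : Finset (Fin 9 → ZMod 2)) (t l : Fin 9 → ZMod 2) :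
    charSum (S.image (· + t)) l = sgn (l ⬝ᵥ t) * charSum S l := by
  rw [charSum, Finset.sum_image fun _ _ _ _ h => add_right_cancel h, charSum, Finset.mul_sum]
  refine Finset.sum_congr rfl fun v _ => ?_
  rw [dotProduct_add, sgn_add, mul_comm]

theorem HasMoments.abs_charSum_le {S : Finset (Fin 9 → ZMod 2)} (hS : HasMoments S)
    {l : Fin 9 → ZMod 2} (hl : l ≠ 0) : |charSum S l| ≤ S.card - 16 := by
  have h0 := hS.eight_le_card_filter hl 0
  have h1 := hS.eight_le_card_filter hl 1
  have h2 := card_eq_card_filter_add S l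
  rw [charSum_eq, abs_le]
  omega

theorem HasMoments.abs_charSum_le_of_block {S : Finset (Fin 9 → ZMod 2)} (hS : HasMoments S)
    {l : Fin 9 → ZMod 2} (hl : block 0 l ≠ 0) : |charSum S l| ≤ S.card - 20 := by
  have h0 := hS.ten_le_card_filter hl 0
  have h1 := hS.ten_le_card_filter hl 1
  have h2 := card_eq_card_filter_add S l
  rw [charSum_eq, abs_le]
  omega

theorem HasMoments.four_dvd_card_add_charSum {S : Finset (Fin 9 → ZMod 2)} (hS : HasMoments S)
    (l : Fin 9 → ZMod 2) : (4 : ℤ) ∣ S.card + charSum S l := by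
  obtain ⟨r, hr⟩ := hS.even_card_filter l 0
  have h2 := card_eq_card_filter_add S l
  rw [charSum_eq]
  omega

theorem HasMoments.eight_dvd_charSum {S : Finset (Fin 9 → ZMod 2)} (hS : HasMoments S)
    (l m : Fin 9 → ZMod 2) :
    (8 : ℤ) ∣ S.card + charSum S l + charSum S m + charSum S (l + m) := by
  obtain ⟨r, hr⟩ := hS.even_card_filter₂ l m 0 0
  have : S.card + charSum S l + charSum S m + charSum S (l + m) =
      4 * ((S.filter fun v => l ⬝ᵥ v = 0 ∧ m ⬝ᵥ v = 0).card : ℤ) := by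
    rw [Finset.card_eq_sum_ones, Finset.card_filter, Nat.cast_sum, Nat.cast_sum, Finset.mul_sum,
      charSum, charSum, charSum, ← Finset.sum_add_distrib, ← Finset.sum_add_distrib,
      ← Finset.sum_add_distrib]
    refine Finset.sum_congr rfl fun v _ => ?_
    rw [add_dotProduct]
    generalize l ⬝ᵥ v = x
    generalize m ⬝ᵥ v = y
    revert x y
    decide
  omega

theorem HasMoments.exists_charSum_eq {S : Finset (Fin 9 → ZMod 2)} (hS : HasMoments S)
    (l m n : Fin 9 → ZMod 2) : ∃ z : ℕ, (z : ZMod 2) = altForm l m n ∧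
      S.card + charSum S l + charSum S m + charSum S n + charSum S (l + m) +
        charSum S (l + n) + charSum S (m + n) + charSum S (l + m + n) = 8 * z := by
  refine ⟨_, hS.natCast_card_filter l m n 0 0 0, ?_⟩
  rw [Finset.card_eq_sum_ones, Finset.card_filter, Nat.cast_sum, Nat.cast_sum, Finset.mul_sum]
  simp only [charSum, ← Finset.sum_add_distrib]
  refine Finset.sum_congr rfl fun v _ => ?_
  simp only [add_dotProduct]
  generalize l ⬝ᵥ v = x
  generalize m ⬝ᵥ v = y
  generalize n ⬝ᵥ v = z
  revert x y z
  decide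

theorem sum_sgn_eq_zero {U : Finset (Fin 9 → ZMod 2)} {d : Fin 9 → ZMod 2}
    {f : (Fin 9 → ZMod 2) → ZMod 2} (hU : ∀ l ∈ U, l + d ∈ U)
    (hf : ∀ l ∈ U, f (l + d) = f l + 1) : ∑ l ∈ U, sgn (f l) = 0 := by
  have hdd (l : Fin 9 → ZMod 2) : l + d + d = l := by
    rw [add_assoc, CharTwo.add_self_eq_zero, add_zero]
  have h : ∑ l ∈ U, sgn (f l) = ∑ l ∈ U, -sgn (f l) := by
    refine Finset.sum_nbij' (· + d) (· + d) hU hU (fun l _ => hdd l) (fun l _ => hdd l)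
      fun l hl => ?_
    rw [hf l hl, sgn_add]
    simp [sgn]
  rw [Finset.sum_neg_distrib] at h
  omega

theorem exists_add_single_dotProduct {v : Fin 9 → ZMod 2} {i : Fin 9} (hi : v i ≠ 0)
    (l : Fin 9 → ZMod 2) : (l + Pi.single i 1) ⬝ᵥ v = l ⬝ᵥ v + 1 := by
  have key : ∀ x : ZMod 2, x ≠ 0 → x = 1 := by decide
  rw [add_dotProduct, single_dotProduct, one_mul, key _ hi]

theorem sum_sgn_dotProduct (v : Fin 9 → ZMod 2) :
    ∑ l : Fin 9 → ZMod 2, sgn (l ⬝ᵥ v) = if v = 0 then 512 else 0 := by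
  split_ifs with h
  · simp [h, sgn]
  · obtain ⟨i, hi⟩ := Function.ne_iff.mp h
    exact sum_sgn_eq_zero (fun _ _ => Finset.mem_univ _)
      fun l _ => exists_add_single_dotProduct hi l

/-- The six-dimensional subspace of linear forms `l` for which `altForm l` has rank six. -/
def singularSpace : Finset (Fin 9 → ZMod 2) := Finset.univ.filter fun l => block 0 l = 0

theorem mem_singularSpace {l : Fin 9 → ZMod 2} : l ∈ singularSpace ↔ block 0 l = 0 := by
  simp [singularSpace]

theorem card_singularSpace : singularSpace.card = 64 := by
  decide +kernel

theorem zero_mem_singularSpace : 0 ∈ singularSpace :=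
  mem_singularSpace.mpr rfl

theorem add_mem_singularSpace {l m : Fin 9 → ZMod 2} (hl : l ∈ singularSpace)
    (hm : m ∈ singularSpace) : l + m ∈ singularSpace := by
  rw [mem_singularSpace] at *
  change block 0 l + block 0 m = 0
  rw [hl, hm, add_zero]

/-- The annihilator of `singularSpace`. -/
def annihilator : Finset (Fin 9 → ZMod 2) :=
  Finset.univ.filter fun v => block 1 v = 0 ∧ block 2 v = 0

theorem sum_singularSpace_sgn (v : Fin 9 → ZMod 2) :
    ∑ l ∈ singularSpace, sgn (l ⬝ᵥ v) = if v ∈ annihilator then 64 else 0 := by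
  split_ifs with h
  · have h0 : ∀ l ∈ singularSpace, sgn (l ⬝ᵥ v) = 1 := by
      intro l hl
      rw [mem_singularSpace] at hl
      obtain ⟨h1, h2⟩ := (Finset.mem_filter.mp h).2
      have : l ⬝ᵥ v = 0 := by
        rw [dotProduct, ← Equiv.sum_comp (finProdFinEquiv : Fin 3 × Fin 3 ≃ Fin 9),
          Fintype.sum_prod_type]
        change ∑ n : Fin 3, ∑ i : Fin 3, block n l i * block n v i = 0
        simp [Fin.sum_univ_three, hl, h1, h2]
      rw [this, sgn_zero]
    rw [Finset.sum_congr rfl h0, Finset.sum_const, card_singularSpace]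
    rfl
  · obtain ⟨n, hn, i, hi⟩ : ∃ n : Fin 3, n ≠ 0 ∧ ∃ i, block n v i ≠ 0 := by
      by_contra! H
      exact h (Finset.mem_filter.mpr ⟨Finset.mem_univ _, funext (H 1 (by decide)),
        funext (H 2 (by decide))⟩)
    refine sum_sgn_eq_zero (d := Pi.single (finProdFinEquiv (n, i)) 1)
      (fun l hl => add_mem_singularSpace hl (mem_singularSpace.mpr (funext fun j => ?_)))
      fun l _ => exists_add_single_dotProduct hi l
    refine Pi.single_eq_of_ne (fun h' => hn ?_) _
    exact (congrArg Prod.fst (finProdFinEquiv.injective h')).symm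

theorem sum_charSum (S : Finset (Fin 9 → ZMod 2)) :
    ∑ l, charSum S l = if 0 ∈ S then 512 else 0 := by
  simp only [charSum]
  rw [Finset.sum_comm]
  simp [sum_sgn_dotProduct]

theorem sum_charSum_sq (S : Finset (Fin 9 → ZMod 2)) :
    ∑ l, charSum S l ^ 2 = 512 * S.card := by
  have h (l : Fin 9 → ZMod 2) :
      charSum S l ^ 2 = ∑ v ∈ S, ∑ w ∈ S, sgn (l ⬝ᵥ (v + w)) := by
    rw [sq, charSum, Finset.sum_mul_sum]
    simp only [dotProduct_add, sgn_add]
  simp only [h]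
  rw [Finset.sum_comm]
  have h' (v) (hv : v ∈ S) : ∑ l, ∑ w ∈ S, sgn (l ⬝ᵥ (v + w)) = 512 := by
    rw [Finset.sum_comm]
    simp only [sum_sgn_dotProduct, CharTwo.add_eq_zero]
    rw [Finset.sum_ite_eq, if_pos hv]
  rw [Finset.sum_congr rfl h', Finset.sum_const, nsmul_eq_mul, mul_comm]

theorem sum_singularSpace_charSum (S : Finset (Fin 9 → ZMod 2)) (e : Fin 9 → ZMod 2) :
    ∑ l ∈ singularSpace, charSum S (e + l) = 64 * ∑ v ∈ S ∩ annihilator, sgn (e ⬝ᵥ v) := by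
  simp only [charSum, add_dotProduct, sgn_add]
  rw [Finset.sum_comm]
  simp only [← Finset.mul_sum, sum_singularSpace_sgn]
  rw [Finset.mul_sum, ← Finset.filter_mem_eq_inter, Finset.sum_filter]
  exact Finset.sum_congr rfl fun v _ => by split_ifs <;> ring

theorem block_zero_single_ne_zero : block 0 (Pi.single 0 1) ≠ 0 :=
  fun h => absurd (congrFun h 0) (by decide)

theorem HasMoments.twenty_six_le_card {S : Finset (Fin 9 → ZMod 2)} (hS : HasMoments S) :
    26 ≤ S.card := by
  by_contra! hlt
  have h20 : 20 ≤ S.card := by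
    have h0 := hS.ten_le_card_filter block_zero_single_ne_zero 0
    have h1 := hS.ten_le_card_filter block_zero_single_ne_zero 1
    have h2 := card_eq_card_filter_add S (Pi.single 0 1)
    omega
  obtain ⟨r, hr⟩ := hS.even_card
  have hsum := sum_charSum_sq S
  rw [← Finset.sum_add_sum_compl singularSpace,
    ← Finset.add_sum_erase _ _ zero_mem_singularSpace, charSum_zero] at hsum
  have h1 : ∑ l ∈ singularSpace.erase 0, charSum S l ^ 2 ≤ 63 * ((S.card : ℤ) - 16) ^ 2 := by
    refine (Finset.sum_le_card_nsmul _ _ (((S.card : ℤ) - 16) ^ 2) fun l hl => ?_).trans ?_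
    · exact sq_le_sq.mpr ((hS.abs_charSum_le (Finset.ne_of_mem_erase hl)).trans (le_abs_self _))
    · rw [Finset.card_erase_of_mem zero_mem_singularSpace, card_singularSpace, nsmul_eq_mul]
      rfl
  have h2 : ∑ l ∈ singularSpaceᶜ, charSum S l ^ 2 ≤ 448 * ((S.card : ℤ) - 20) ^ 2 := by
    refine (Finset.sum_le_card_nsmul _ _ (((S.card : ℤ) - 20) ^ 2) fun l hl => ?_).trans ?_
    · rw [Finset.mem_compl, mem_singularSpace] at hl
      exact sq_le_sq.mpr ((hS.abs_charSum_le_of_block hl).trans (le_abs_self _))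
    · rw [Finset.card_compl, card_singularSpace, nsmul_eq_mul]
      simp
  have : S.card = 20 ∨ S.card = 22 ∨ S.card = 24 := by omega
  rcases this with h | h | h <;> rw [h] at hsum h1 h2 <;> norm_num at hsum h1 h2 <;> linarith

theorem HasMoments.exists_image_add {S : Finset (Fin 9 → ZMod 2)} (hS : HasMoments S)
    (hcard : S.card = 26) : ∃ t, ∀ l, (8 : ℤ) ∣ charSum (S.image (· + t)) l - 2 := by
  have h4 (l : Fin 9 → ZMod 2) : ∃ k : ℤ, charSum S l = 26 + 4 * k := by
    have := hS.four_dvd_card_add_charSum l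
    exact ⟨(charSum S l - 26) / 4, by omega⟩
  choose k hk using h4
  have hadd (l m : Fin 9 → ZMod 2) : (k (l + m) : ZMod 2) = k l + k m := by
    have := hS.eight_dvd_charSum l m
    rw [hk, hk, hk, hcard] at this
    rw [← Int.cast_add]
    exact (ZMod.intCast_eq_intCast_iff_dvd_sub _ _ 2).mpr (by push_cast at *; omega)
  let φ := (AddMonoidHom.mk' (fun l => (k l : ZMod 2)) hadd).toZModLinearMap 2
  refine ⟨fun i => φ fun j => if i = j then 1 else 0, fun l => ?_⟩
  have hφ : (l ⬝ᵥ fun i => φ fun j => if i = j then 1 else 0) = (k l : ZMod 2) := by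
    change _ = φ l
    rw [LinearMap.pi_apply_eq_sum_univ φ l]
    rfl
  rw [charSum_image_add, hφ, hk, sgn]
  split_ifs with h
  · have := (ZMod.intCast_zmod_eq_zero_iff_dvd (k l) 2).mp h
    push_cast at this
    omega
  · rw [ZMod.intCast_zmod_eq_zero_iff_dvd] at h
    push_cast at h
    omega

/-- The form `altForm l` is nondegenerate on `singularSpace` for `l` the first unit vector. -/
theorem exists_mem_singularSpace_altForm_eq_one {d : Fin 9 → ZMod 2} (hd : d ∈ singularSpace)
    (hd0 : d ≠ 0) : ∃ u ∈ singularSpace, altForm (Pi.single 0 1) d u = 1 := by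
  by_contra! H
  have key : ∀ x : ZMod 2, x ≠ 1 → x = 0 := by decide
  obtain ⟨h1, h2⟩ := mulGF8_block_add_eq_zero_of_altForm fun u hu =>
    key _ (H u (mem_singularSpace.mpr hu))
  rw [mem_singularSpace] at hd
  rw [hd, mulGF8_zero, add_zero] at h1 h2
  exact hd0 (eq_zero_of_blocks hd (eq_zero_of_mulGF8_eq_zero block_zero_single_ne_zero h1)
    (eq_zero_of_mulGF8_eq_zero block_zero_single_ne_zero h2))

theorem HasMoments.charSum_mem {S : Finset (Fin 9 → ZMod 2)} (hS : HasMoments S)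
    (hcard : S.card = 26) (hmod : ∀ l, (8 : ℤ) ∣ charSum S l - 2) {l : Fin 9 → ZMod 2}
    (hl : l ≠ 0) : charSum S l = 10 ∨ charSum S l = 2 ∨ charSum S l = -6 := by
  have h1 := abs_le.mp (hS.abs_charSum_le hl)
  have := hmod l
  rw [hcard] at h1
  omega

theorem HasMoments.charSum_mem_of_block {S : Finset (Fin 9 → ZMod 2)} (hS : HasMoments S)
    (hcard : S.card = 26) (hmod : ∀ l, (8 : ℤ) ∣ charSum S l - 2) {l : Fin 9 → ZMod 2}
    (hl : block 0 l ≠ 0) : charSum S l = 2 ∨ charSum S l = -6 := by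
  have h1 := abs_le.mp (hS.abs_charSum_le_of_block hl)
  have := hmod l
  rw [hcard] at h1
  omega

/-- A set of `26` vectors with the moments of `sextic`, suitably translated, contains the
nonzero vectors of the annihilator of the singular subspace. -/
theorem HasMoments.inter_annihilator {S : Finset (Fin 9 → ZMod 2)} (hS : HasMoments S)
    (hcard : S.card = 26) (hmod : ∀ l, (8 : ℤ) ∣ charSum S l - 2) :
    S ∩ annihilator = annihilator.erase 0 ∧
      ∀ l ∈ singularSpace, (16 : ℤ) ∣ charSum S l - 10 := by
  have hcompl : ∑ l ∈ singularSpaceᶜ, (charSum S l - 2) * (charSum S l + 6) = 0 := by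
    refine Finset.sum_eq_zero fun l hl => ?_
    rw [Finset.mem_compl, mem_singularSpace] at hl
    rcases hS.charSum_mem_of_block hcard hmod hl with h | h <;> simp [h]
  have htotal : ∑ l, (charSum S l - 2) * (charSum S l + 6) =
      7168 + 4 * if 0 ∈ S then 512 else 0 := by
    have (x : ℤ) : (x - 2) * (x + 6) = x ^ 2 + 4 * x - 12 := by ring
    simp only [this, Finset.sum_sub_distrib, Finset.sum_add_distrib, ← Finset.mul_sum,
      sum_charSum_sq, sum_charSum, hcard]
    simp
    ring
  have hcard63 : (singularSpace.erase 0).card = 63 := by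
    rw [Finset.card_erase_of_mem zero_mem_singularSpace, card_singularSpace]
  have hz : charSum S 0 = 26 := by rw [charSum_zero, hcard]; rfl
  rw [← Finset.sum_add_sum_compl singularSpace, hcompl, add_zero,
    ← Finset.add_sum_erase _ _ zero_mem_singularSpace, hz] at htotal
  have hle : ∑ l ∈ singularSpace.erase 0, (charSum S l - 2) * (charSum S l + 6) ≤ 63 * 128 := by
    refine (Finset.sum_le_card_nsmul _ _ 128 fun l hl => ?_).trans ?_
    · rcases hS.charSum_mem hcard hmod (Finset.ne_of_mem_erase hl) with h | h | h <;> simp [h]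
    · simp [hcard63]
  have h0 : 0 ∉ S := by
    intro h
    rw [if_pos h] at htotal
    omega
  rw [if_neg h0] at htotal
  have hsub : S ∩ annihilator ⊆ annihilator.erase 0 := fun v hv => by
    obtain ⟨hvS, hvA⟩ := Finset.mem_inter.mp hv
    exact Finset.mem_erase.mpr ⟨fun h => h0 (h ▸ hvS), hvA⟩
  have hcard7 : (annihilator.erase 0).card = 7 := by decide +kernel
  have hle7 := (Finset.card_le_card hsub).trans hcard7.le
  have hU := sum_singularSpace_charSum S 0
  simp only [zero_add, zero_dotProduct, sgn_zero, Finset.sum_const, nsmul_eq_mul, mul_one] at hU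
  rw [← Finset.add_sum_erase _ _ zero_mem_singularSpace, hz] at hU
  have hnonpos (l) (hl : l ∈ singularSpace.erase 0) :
      (charSum S l - 10) * (charSum S l + 6) ≤ 0 := by
    rcases hS.charSum_mem hcard hmod (Finset.ne_of_mem_erase hl) with h | h | h <;> simp [h]
  have hrel : ∑ l ∈ singularSpace.erase 0, (charSum S l - 10) * (charSum S l + 6) =
      ∑ l ∈ singularSpace.erase 0, (charSum S l - 2) * (charSum S l + 6) -
        8 * ∑ l ∈ singularSpace.erase 0, charSum S l - 48 * 63 := by
    have (x : ℤ) : (x - 10) * (x + 6) = (x - 2) * (x + 6) - 8 * x - 48 := by ring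
    simp only [this, Finset.sum_sub_distrib, ← Finset.mul_sum, Finset.sum_const, hcard63]
    simp
  have hsum_nonpos := Finset.sum_nonpos hnonpos
  have hinter : (S ∩ annihilator).card = 7 := by omega
  have hzero := (Finset.sum_eq_zero_iff_of_nonpos hnonpos).mp (by omega)
  refine ⟨Finset.eq_of_subset_of_card_le hsub (by omega), fun l hl => ?_⟩
  by_cases hl0 : l = 0
  · rw [hl0, hz]
    norm_num
  · rcases mul_eq_zero.mp (hzero l (Finset.mem_erase.mpr ⟨hl0, hl⟩)) with h | h <;> omega

theorem HasMoments.card_ne_of_dvd {S : Finset (Fin 9 → ZMod 2)} (hS : HasMoments S)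
    (hmod : ∀ l, (8 : ℤ) ∣ charSum S l - 2) : S.card ≠ 26 := by
  intro hcard
  obtain ⟨hinter, h16⟩ := hS.inter_annihilator hcard hmod
  set e : Fin 9 → ZMod 2 := Pi.single 0 1 with he
  have hblock (u) (hu : u ∈ singularSpace) : block 0 (e + u) ≠ 0 := by
    rw [mem_singularSpace] at hu
    change block 0 e + block 0 u ≠ 0
    rw [hu, add_zero]
    exact block_zero_single_ne_zero
  have hsum : ∑ u ∈ singularSpace, charSum S (e + u) = -64 := by
    have : ∑ v ∈ annihilator.erase 0, sgn (e ⬝ᵥ v) = -1 := by decide +kernel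
    rw [sum_singularSpace_charSum, hinter, this]
    rfl
  have hq (u : Fin 9 → ZMod 2) : ∃ q : ℤ, u ∈ singularSpace →
      (q = 1 ∨ q = -1) ∧ charSum S (e + u) = -2 - 4 * q := by
    by_cases hu : u ∈ singularSpace
    · rcases hS.charSum_mem_of_block hcard hmod (hblock u hu) with h | h
      · exact ⟨-1, fun _ => ⟨Or.inr rfl, h⟩⟩
      · exact ⟨1, fun _ => ⟨Or.inl rfl, h⟩⟩
    · exact ⟨0, fun h => absurd h hu⟩
  choose q hq using hq
  have hqsum : ∑ u ∈ singularSpace, q u = -16 := by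
    rw [Finset.sum_congr rfl fun u hu => (hq u hu).2, Finset.sum_sub_distrib, ← Finset.mul_sum,
      Finset.sum_const, card_singularSpace] at hsum
    norm_num at hsum
    omega
  have hderiv (d u) (hd : d ∈ singularSpace) (hu : u ∈ singularSpace) :
      q u * q (u + d) = q 0 * q d * sgn (altForm e d u) := by
    obtain ⟨z, hz, h⟩ := hS.exists_charSum_eq e d u
    obtain ⟨h1, h2⟩ := hq u hu
    obtain ⟨h3, h4⟩ := hq d hd
    obtain ⟨h5, h6⟩ := hq _ (add_mem_singularSpace hu hd)
    obtain ⟨h7, h8⟩ := hq 0 zero_mem_singularSpace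
    rw [add_zero] at h8
    rw [← add_assoc, add_right_comm] at h6
    have h9 := h16 d hd
    have h10 := h16 u hu
    have h11 := h16 _ (add_mem_singularSpace hd hu)
    rw [h2, h4, h6, h8, hcard] at h
    rw [← hz, sgn]
    simp only [ZMod.natCast_eq_zero_iff]
    generalize q u = a at *
    generalize q d = b at *
    generalize q (u + d) = c at *
    generalize q 0 = f at *
    split_ifs with h12 <;> rcases h1 with rfl | rfl <;> rcases h3 with rfl | rfl <;>
      rcases h5 with rfl | rfl <;> rcases h7 with rfl | rfl <;> norm_num at h ⊢ <;> omega
  have hcorr (d) (hd : d ∈ singularSpace) (hd0 : d ≠ 0) :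
      ∑ u ∈ singularSpace, q u * q (u + d) = 0 := by
    rw [Finset.sum_congr rfl fun u hu => hderiv d u hd hu, ← Finset.mul_sum]
    obtain ⟨w, hw, hw1⟩ := exists_mem_singularSpace_altForm_eq_one hd hd0
    rw [sum_sgn_eq_zero (fun u hu => add_mem_singularSpace hu hw) fun u _ => by
      rw [altForm_add_right, hw1], mul_zero]
  have hsq : (∑ u ∈ singularSpace, q u) ^ 2 =
      ∑ d ∈ singularSpace, ∑ u ∈ singularSpace, q u * q (u + d) := by
    rw [sq, Finset.sum_mul_sum, Finset.sum_comm' (t' := singularSpace)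
      (s' := fun _ => singularSpace) (by tauto)]
    have hself (u d : Fin 9 → ZMod 2) : u + (u + d) = d := by
      rw [← add_assoc, CharTwo.add_self_eq_zero, zero_add]
    rw [Finset.sum_comm, Finset.sum_comm (s := singularSpace) (t := singularSpace)
      (f := fun d u => q u * q (u + d))]
    refine Finset.sum_congr rfl fun u hu => ?_
    exact Finset.sum_nbij' (u + ·) (u + ·) (fun d hd => add_mem_singularSpace hu hd)
      (fun d hd => add_mem_singularSpace hu hd) (fun d _ => hself u d) (fun d _ => hself u d)
      fun d _ => by rw [hself]
  rw [hqsum, ← Finset.add_sum_erase _ _ zero_mem_singularSpace, Finset.sum_eq_zero fun d hd =>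
    hcorr d (Finset.mem_of_mem_erase hd) (Finset.ne_of_mem_erase hd)] at hsq
  have hone : ∀ u ∈ singularSpace, q u * q (u + 0) = 1 := fun u hu => by
    rw [add_zero]
    rcases (hq u hu).1 with h | h <;> simp [h]
  rw [Finset.sum_congr rfl hone, Finset.sum_const, card_singularSpace] at hsq
  norm_num at hsq

theorem HasMoments.twenty_eight_le_card {S : Finset (Fin 9 → ZMod 2)} (hS : HasMoments S) :
    28 ≤ S.card := by
  have h26 := hS.twenty_six_le_card
  obtain ⟨r, hr⟩ := hS.even_card
  have hne : S.card ≠ 26 := fun hcard => by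
    obtain ⟨t, ht⟩ := hS.exists_image_add hcard
    refine (hS.image_add t).card_ne_of_dvd ht ?_
    rw [Finset.card_image_of_injective _ (add_left_injective t), hcard]
  omega

/-- The covering radius of `RM(5,9)` in `RM(6,9)` is at least 28. -/
theorem stmt8 : ∃ f : BF 9, deg f ≤ 6 ∧ 28 ≤ distRM 9 5 f := by
  refine ⟨sextic, deg_sextic_le, le_csInf ⟨_, 0, ?_, rfl⟩ ?_⟩
  · simp [deg, repPoly]
  · rintro w ⟨p, hp, rfl⟩
    exact (hasMoments_support hp).twenty_eight_le_card
end
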